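/- The graph F(9,15,31), defined as the simple graph on vertex set {1,...,9} with edge set {{1,2},{2,3},{3,4},{4,6},{3,6},{3,7},{2,7},{2,5},{1,5},{7,8},{8,9},{7,9},{1,8},{4,9},{5,6}}, is forbidden: there is no injective map φ : {1,...,9} → ℝ² with dist(φ(i), φ(j)) = 1 for every edge {i,j}. -/

import Mathlib

theorem sq_of_dist (p q : EuclideanSpace ℝ (Fin 2)) (h : dist p q = 1) :
    (p 0 - q 0) ^ 2 + (p 1 - q 1) ^ 2 = 1 := by
  rw [EuclideanSpace.dist_eq, Real.sqrt_eq_one, Fin.sum_univ_two, Real.dist_eq, Real.dist_eq,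
    sq_abs, sq_abs] at h
  exact h

theorem ne_sq (p q : EuclideanSpace ℝ (Fin 2)) (h : p ≠ q) :
    (p 0 - q 0) ^ 2 + (p 1 - q 1) ^ 2 ≠ 0 := by
  intro h0
  apply h
  have h1 : p 0 - q 0 = 0 := by nlinarith [sq_nonneg (p 0 - q 0), sq_nonneg (p 1 - q 1)]
  have h2 : p 1 - q 1 = 0 := by nlinarith [sq_nonneg (p 0 - q 0), sq_nonneg (p 1 - q 1)]
  ext i
  fin_cases i
  · simpa using sub_eq_zero.mp h1
  · simpa using sub_eq_zero.mp h2

/-- A unit 4-cycle `p q r s` with distinct vertices is a rhombus. -/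
theorem rhombus (p q r s : EuclideanSpace ℝ (Fin 2)) (hpr : p ≠ r) (hqs : q ≠ s)
    (h1 : dist p q = 1) (h2 : dist q r = 1) (h3 : dist r s = 1) (h4 : dist p s = 1) :
    q 0 - p 0 = r 0 - s 0 ∧ q 1 - p 1 = r 1 - s 1 := by
  have e1 := sq_of_dist _ _ h1
  have e2 := sq_of_dist _ _ h2
  have e3 := sq_of_dist _ _ h3
  have e4 := sq_of_dist _ _ h4
  have n1 := ne_sq _ _ hpr
  have n2 := ne_sq _ _ hqs
  generalize p 0 = a at *
  generalize p 1 = b at *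
  generalize q 0 = c at *
  generalize q 1 = d at *
  generalize r 0 = e at *
  generalize r 1 = f at *
  generalize s 0 = g at *
  generalize s 1 = h at *
  have o1 : (a - e) * (c - g) + (b - f) * (d - h) = 0 := by linarith
  have z1 : (a + e - c - g) * (c - g) + (b + f - d - h) * (d - h) = 0 := by linarith
  have z2 : (a + e - c - g) * (a - e) + (b + f - d - h) * (b - f) = 0 := by linarith
  have hD : (a - e) * (d - h) - (b - f) * (c - g) ≠ 0 := by
    intro hD
    apply mul_ne_zero n1 n2
    linear_combination ((a - e) * (c - g) + (b - f) * (d - h)) * o1 +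
      ((a - e) * (d - h) - (b - f) * (c - g)) * hD
  have k1 : a + e - c - g = 0 := by
    apply (mul_eq_zero.mp _).resolve_right hD
    linear_combination (d - h) * z2 - (b - f) * z1
  have k2 : b + f - d - h = 0 := by
    apply (mul_eq_zero.mp _).resolve_right hD
    linear_combination (a - e) * z1 - (c - g) * z2
  constructor <;> linarith

theorem noK4 (a b c d e f : ℝ) (h1 : a ^ 2 + b ^ 2 = 1) (h2 : c ^ 2 + d ^ 2 = 1)
    (h3 : e ^ 2 + f ^ 2 = 1) (h4 : (a - c) ^ 2 + (b - d) ^ 2 = 1)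
    (h5 : (c - e) ^ 2 + (d - f) ^ 2 = 1) (h6 : (a - e) ^ 2 + (b - f) ^ 2 = 1) : False := by
  have i1 : a * c + b * d = 1 / 2 := by linarith
  have i2 : c * e + d * f = 1 / 2 := by linarith
  have i3 : a * e + b * f = 1 / 2 := by linarith
  have key : (a ^ 2 + b ^ 2) * (c ^ 2 + d ^ 2) * (e ^ 2 + f ^ 2)
      + 2 * (a * c + b * d) * (c * e + d * f) * (a * e + b * f)
      - (a ^ 2 + b ^ 2) * (c * e + d * f) ^ 2 - (c ^ 2 + d ^ 2) * (a * e + b * f) ^ 2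
      - (e ^ 2 + f ^ 2) * (a * c + b * d) ^ 2 = 0 := by ring
  rw [h1, h2, h3, i1, i2, i3] at key
  norm_num at key


theorem F_9_15_31_forbidden :
    ¬ ∃ φ : ℕ → EuclideanSpace ℝ (Fin 2),
      Set.InjOn φ (Set.Icc 1 9) ∧
      dist (φ 1) (φ 2) = 1 ∧
      dist (φ 2) (φ 3) = 1 ∧
      dist (φ 3) (φ 4) = 1 ∧
      dist (φ 4) (φ 6) = 1 ∧
      dist (φ 3) (φ 6) = 1 ∧
      dist (φ 3) (φ 7) = 1 ∧
      dist (φ 2) (φ 7) = 1 ∧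
      dist (φ 2) (φ 5) = 1 ∧
      dist (φ 1) (φ 5) = 1 ∧
      dist (φ 7) (φ 8) = 1 ∧
      dist (φ 8) (φ 9) = 1 ∧
      dist (φ 7) (φ 9) = 1 ∧
      dist (φ 1) (φ 8) = 1 ∧
      dist (φ 4) (φ 9) = 1 ∧
      dist (φ 5) (φ 6) = 1 := by

  rintro ⟨φ, inj, h12, h23, h34, h46, h36, h37, h27, h25, h15, h78, h89, h79, h18, h49, h56⟩
  have ne : ∀ i j : ℕ, 1 ≤ i → i ≤ 9 → 1 ≤ j → j ≤ 9 → i ≠ j → φ i ≠ φ j :=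
    fun i j a b c d hij h => hij (inj ⟨a, b⟩ ⟨c, d⟩ h)
  obtain ⟨a1, a2⟩ := rhombus (φ 2) (φ 5) (φ 6) (φ 3) (ne _ _ (by simp) (by simp) (by simp) (by simp) (by simp))
    (ne _ _ (by simp) (by simp) (by simp) (by simp) (by simp)) h25 h56 (by rwa [dist_comm]) h23
  obtain ⟨b1, b2⟩ := rhombus (φ 3) (φ 4) (φ 9) (φ 7) (ne _ _ (by simp) (by simp) (by simp) (by simp) (by simp))
    (ne _ _ (by simp) (by simp) (by simp) (by simp) (by simp)) h34 h49 (by rwa [dist_comm]) h37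
  obtain ⟨c1, c2⟩ := rhombus (φ 2) (φ 1) (φ 8) (φ 7) (ne _ _ (by simp) (by simp) (by simp) (by simp) (by simp))
    (ne _ _ (by simp) (by simp) (by simp) (by simp) (by simp)) (by rwa [dist_comm]) h18 (by rwa [dist_comm]) h27
  have e25 := sq_of_dist _ _ h25
  have e34 := sq_of_dist _ _ h34
  have e12 := sq_of_dist _ _ h12
  have e46 := sq_of_dist _ _ h46
  have e89 := sq_of_dist _ _ h89
  have e15 := sq_of_dist _ _ h15
  refine noK4 (φ 5 0 - φ 2 0) (φ 5 1 - φ 2 1) (φ 4 0 - φ 3 0) (φ 4 1 - φ 3 1)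
    (φ 1 0 - φ 2 0) (φ 1 1 - φ 2 1) (by linarith) (by linarith) (by linarith) ?_ ?_ (by linarith)
  · rw [a1, a2]; linarith
  · rw [b1, b2, c1, c2]; linarith
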